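/- arXiv:2402.06618 — 3 statements merged into one kernel-verified Lean document; each statement's English description precedes it below -/
import Mathlib

section
/- For every n ≥ 1, the composition q_n = h_n ∘ q_{n-1} : [0,1] → [0,1] is bijective and continuously differentiable, with q_n(0) = n mod 2 (i.e. 0 if n is even, 1 if n is odd) and q_n(1) − q_n(0) = (−1)^n. -/
open Set MeasureTheory Polynomial

noncomputable section

/-- The class `E` of antitone functions `g : [0,1] → [0,1]` with `g 0 = 1` and
positive integral (functions are modelled as total functions `ℝ → ℝ`,
constrained on `[0,1]`). -/
def E : Set (ℝ → ℝ) :=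
  {g | AntitoneOn g (Icc 0 1) ∧ MapsTo g (Icc 0 1) (Icc 0 1) ∧ g 0 = 1 ∧
    0 < ∫ x in (0:ℝ)..1, g x}

/-- The pseudo-inverse `g*` of `g`, given by `g* y = sup {x ∈ [0,1] | g x ≥ y}`. -/
def pseudoInv (g : ℝ → ℝ) : ℝ → ℝ := fun y => sSup {x | x ∈ Icc (0:ℝ) 1 ∧ y ≤ g x}

/-- The stribolic operator `T`, `(T g) x = (∫_x^1 g*) / (∫_0^1 g)`. -/
def T (g : ℝ → ℝ) : ℝ → ℝ := fun x =>
  (∫ t in x..(1:ℝ), pseudoInv g t) / (∫ t in (0:ℝ)..1, g t)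

/-- The canonical stribolic iterates: `h 0 = 1` and `h (n+1) = T (h n)`. -/
def h : ℕ → ℝ → ℝ
  | 0 => fun _ => 1
  | n + 1 => T (h n)

/-- `κ n = ∫_0^1 h n`. -/
def κ (n : ℕ) : ℝ := ∫ t in (0:ℝ)..1, h n t

/-- The compositions `q n = h n ∘ ⋯ ∘ h 1`, with `q 0 = id`. -/
def q : ℕ → ℝ → ℝ
  | 0 => fun x => x
  | n + 1 => h (n + 1) ∘ q n

/-- `q (n-1)`, with the convention that for `n = 0` (i.e. "`q (-1)`") it is the
constant function `1` (the only convention making the `n = 0` cases hold). -/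
def qprev : ℕ → ℝ → ℝ
  | 0 => fun _ => 1
  | n + 1 => q n

/-- `Q n x = ∫_0^x (q n)' (t) * q (n-1) (t) dt`. -/
def Q (n : ℕ) (x : ℝ) : ℝ := ∫ t in (0:ℝ)..x, deriv (q n) t * qprev n t

/-- `g` restricts to a continuously differentiable decreasing bijection of the unit interval. -/
def IsDecreasingC1 (g : ℝ → ℝ) : Prop :=
  ContDiffOn ℝ 1 g (Icc 0 1) ∧ StrictAntiOn g (Icc 0 1) ∧ g 0 = 1 ∧ g 1 = 0

theorem IsDecreasingC1.mapsTo {g : ℝ → ℝ} (hg : IsDecreasingC1 g) :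
    MapsTo g (Icc 0 1) (Icc 0 1) := by
  obtain ⟨-, hanti, h0, h1⟩ := hg
  intro x hx
  have hl := hanti.antitoneOn hx (right_mem_Icc.2 zero_le_one) hx.2
  have hu := hanti.antitoneOn (left_mem_Icc.2 zero_le_one) hx hx.1
  exact ⟨h1 ▸ hl, h0 ▸ hu⟩

theorem IsDecreasingC1.surjOn {g : ℝ → ℝ} (hg : IsDecreasingC1 g) :
    SurjOn g (Icc 0 1) (Icc 0 1) := by
  have hivt := intermediate_value_Icc' zero_le_one hg.1.continuousOn
  rwa [hg.2.2.1, hg.2.2.2] at hivt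

theorem IsDecreasingC1.bijOn {g : ℝ → ℝ} (hg : IsDecreasingC1 g) :
    BijOn g (Icc 0 1) (Icc 0 1) :=
  ⟨hg.mapsTo, hg.2.1.injOn, hg.surjOn⟩

theorem IsDecreasingC1.leftInvOn_pseudoInv {g : ℝ → ℝ} (hg : IsDecreasingC1 g) :
    LeftInvOn (pseudoInv g) g (Icc 0 1) := by
  intro x hx
  have hset : {z | z ∈ Icc (0 : ℝ) 1 ∧ g x ≤ g z} = Icc 0 x := by
    ext z
    constructor
    · rintro ⟨hz, hle⟩
      exact ⟨hz.1, (hg.2.1.le_iff_ge hx hz).1 hle⟩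
    · intro hz
      have hz' : z ∈ Icc (0 : ℝ) 1 := ⟨hz.1, hz.2.trans hx.2⟩
      exact ⟨hz', hg.2.1.antitoneOn hz' hx hz.2⟩
  rw [pseudoInv, hset, csSup_Icc hx.1]

theorem IsDecreasingC1.continuousOn_pseudoInv {g : ℝ → ℝ} (hg : IsDecreasingC1 g) :
    ContinuousOn (pseudoInv g) (Icc 0 1) := by
  rw [continuousOn_iff_isClosed]
  intro t ht
  refine ⟨g '' (Icc 0 1 ∩ t), ?_, ?_⟩
  · exact ((isCompact_Icc.inter_right ht).image_of_continuousOn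
      (hg.1.continuousOn.mono inter_subset_left)).isClosed
  · ext y
    constructor
    · rintro ⟨hyt, hy⟩
      obtain ⟨x, hx, rfl⟩ := hg.surjOn hy
      rw [mem_preimage, hg.leftInvOn_pseudoInv hx] at hyt
      exact ⟨⟨x, ⟨hx, hyt⟩, rfl⟩, hy⟩
    · rintro ⟨⟨x, ⟨hx, hxt⟩, rfl⟩, hy⟩
      exact ⟨by rwa [mem_preimage, hg.leftInvOn_pseudoInv hx], hy⟩

theorem IsDecreasingC1.pseudoInv_pos {g : ℝ → ℝ} (hg : IsDecreasingC1 g) {y : ℝ}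
    (hy : y ∈ Ioo (0 : ℝ) 1) : 0 < pseudoInv g y := by
  obtain ⟨x, hx, rfl⟩ := hg.surjOn (Ioo_subset_Icc_self hy)
  rw [hg.leftInvOn_pseudoInv hx]
  refine lt_of_le_of_ne hx.1 ?_
  rintro rfl
  exact hy.2.ne hg.2.2.1

theorem IsDecreasingC1.integral_pseudoInv {g : ℝ → ℝ} (hg : IsDecreasingC1 g) :
    ∫ t in (0 : ℝ)..1, pseudoInv g t = ∫ t in (0 : ℝ)..1, g t := by
  have hI : uIcc (0 : ℝ) 1 = Icc 0 1 := uIcc_of_le zero_le_one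
  have hcont : ContinuousOn g (uIcc 0 1) := hI ▸ hg.1.continuousOn
  have hdcont : ContinuousOn (derivWithin g (Icc 0 1)) (uIcc 0 1) :=
    hI ▸ hg.1.continuousOn_derivWithin (uniqueDiffOn_Icc zero_lt_one) le_rfl
  have hderiv : ∀ x ∈ Ioo (0 : ℝ) 1, HasDerivAt g (derivWithin g (Icc 0 1) x) x := fun x hx =>
    ((hg.1.differentiableOn one_ne_zero x
      (Ioo_subset_Icc_self hx)).hasDerivWithinAt).hasDerivAt (Icc_mem_nhds hx.1 hx.2)
  have hsubst : ∫ x in (0 : ℝ)..1, (pseudoInv g ∘ g) x * derivWithin g (Icc 0 1) x =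
      ∫ t in g 0..g 1, pseudoInv g t := by
    refine intervalIntegral.integral_comp_mul_deriv'' hcont ?_ hdcont ?_
    · intro x hx
      rw [min_eq_left zero_le_one, max_eq_right zero_le_one] at hx
      exact (hderiv x hx).hasDerivWithinAt
    · rw [hI]
      exact hg.continuousOn_pseudoInv.mono hg.mapsTo.image_subset
  have hcongr : ∫ x in (0 : ℝ)..1, (pseudoInv g ∘ g) x * derivWithin g (Icc 0 1) x =
      ∫ x in (0 : ℝ)..1, x * derivWithin g (Icc 0 1) x := by
    refine intervalIntegral.integral_congr fun x hx => ?_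
    rw [hI] at hx
    simp only [Function.comp, hg.leftInvOn_pseudoInv hx]
  have hparts : ∫ x in (0 : ℝ)..1, x * derivWithin g (Icc 0 1) x =
      1 * g 1 - 0 * g 0 - ∫ x in (0 : ℝ)..1, 1 * g x := by
    refine intervalIntegral.integral_mul_deriv_eq_deriv_mul_of_hasDerivAt
      continuousOn_id hcont (fun x _ => hasDerivAt_id x) ?_ intervalIntegrable_const
      hdcont.intervalIntegrable
    intro x hx
    rw [min_eq_left zero_le_one, max_eq_right zero_le_one] at hx
    exact hderiv x hx
  rw [hcongr, hparts, hg.2.2.1, hg.2.2.2, intervalIntegral.integral_symm 0 1] at hsubst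
  simp only [one_mul] at hsubst
  linarith

theorem isDecreasingC1_integral_div {p : ℝ → ℝ} (hcont : ContinuousOn p (Icc 0 1))
    (hpos : ∀ x ∈ Ioo (0 : ℝ) 1, 0 < p x) :
    IsDecreasingC1 fun x => (∫ t in x..(1 : ℝ), p t) / ∫ t in (0 : ℝ)..1, p t := by
  have hint : ∀ x ∈ Icc (0 : ℝ) 1, IntervalIntegrable p volume x 1 := fun x hx =>
    (hcont.mono (by rw [uIcc_of_le hx.2]; exact Icc_subset_Icc_left hx.1)).intervalIntegrable
  have hκ : 0 < ∫ t in (0 : ℝ)..1, p t :=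
    intervalIntegral.intervalIntegral_pos_of_pos_on (hint 0 (left_mem_Icc.2 zero_le_one))
      hpos zero_lt_one
  set c := ∫ t in (0 : ℝ)..1, p t with hc
  have hderiv : ∀ x ∈ Icc (0 : ℝ) 1,
      HasDerivWithinAt (fun x => (∫ t in x..(1 : ℝ), p t) / c) (-p x / c) (Icc 0 1) x := by
    intro x hx
    have : Fact (x ∈ Icc (0 : ℝ) 1) := ⟨hx⟩
    exact (intervalIntegral.integral_hasDerivWithinAt_left (hint x hx)
      (hcont.stronglyMeasurableAtFilter_nhdsWithin measurableSet_Icc x) (hcont x hx)).div_const c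
  have hdiff : DifferentiableOn ℝ (fun x => (∫ t in x..(1 : ℝ), p t) / c) (Icc 0 1) :=
    fun x hx => (hderiv x hx).differentiableWithinAt
  refine ⟨?_, ?_, ?_, ?_⟩
  · rw [contDiffOn_one_iff_derivWithin (uniqueDiffOn_Icc zero_lt_one)]
    refine ⟨hdiff, (hcont.neg.div_const c).congr fun x hx => ?_⟩
    exact (hderiv x hx).derivWithin (uniqueDiffOn_Icc zero_lt_one x hx)
  · refine strictAntiOn_of_deriv_neg (convex_Icc 0 1) hdiff.continuousOn fun x hx => ?_
    rw [interior_Icc] at hx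
    rw [((hderiv x (Ioo_subset_Icc_self hx)).hasDerivAt (Icc_mem_nhds hx.1 hx.2)).deriv]
    exact div_neg_of_neg_of_pos (neg_neg_of_pos (hpos x hx)) hκ
  · exact div_self hκ.ne'
  · simp

theorem IsDecreasingC1.T {g : ℝ → ℝ} (hg : IsDecreasingC1 g) : IsDecreasingC1 (T g) := by
  have hT := isDecreasingC1_integral_div hg.continuousOn_pseudoInv fun _ => hg.pseudoInv_pos
  rwa [hg.integral_pseudoInv] at hT

theorem pseudoInv_h_zero {y : ℝ} (hy : y ∈ Icc (0 : ℝ) 1) : pseudoInv (h 0) y = 1 := by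
  have hset : {x | x ∈ Icc (0 : ℝ) 1 ∧ y ≤ h 0 x} = Icc 0 1 := by
    ext x
    simp [h, hy.2]
  rw [pseudoInv, hset, csSup_Icc zero_le_one]

theorem isDecreasingC1_h_succ (n : ℕ) : IsDecreasingC1 (h (n + 1)) := by
  induction n with
  | zero =>
    have hint : ∫ t in (0 : ℝ)..1, pseudoInv (h 0) t = ∫ t in (0 : ℝ)..1, h 0 t := by
      refine intervalIntegral.integral_congr fun x hx => ?_
      rw [uIcc_of_le zero_le_one] at hx
      exact pseudoInv_h_zero hx
    have hT := isDecreasingC1_integral_div (p := pseudoInv (h 0))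
      (continuousOn_const.congr fun x hx => pseudoInv_h_zero hx)
      fun x hx => by rw [pseudoInv_h_zero (Ioo_subset_Icc_self hx)]; exact one_pos
    rwa [hint] at hT
  | succ n ih => exact ih.T

theorem bijOn_q (n : ℕ) : BijOn (q n) (Icc 0 1) (Icc 0 1) := by
  induction n with
  | zero => exact bijOn_id _
  | succ n ih => exact (isDecreasingC1_h_succ n).bijOn.comp ih

theorem contDiffOn_q (n : ℕ) : ContDiffOn ℝ 1 (q n) (Icc 0 1) := by
  induction n with
  | zero => exact contDiffOn_id
  | succ n ih => exact (isDecreasingC1_h_succ n).1.comp ih (bijOn_q n).mapsTo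

theorem q_endpoints (n : ℕ) :
    q n 0 = (n % 2 : ℕ) ∧ q n 1 - q n 0 = (-1 : ℝ) ^ n := by
  induction n with
  | zero => simp [q]
  | succ n ih =>
    obtain ⟨hq0, hq1⟩ := ih
    obtain ⟨-, -, h0, h1⟩ := isDecreasingC1_h_succ n
    simp only [q, Function.comp]
    rcases Nat.even_or_odd n with hn | hn
    · rw [Nat.even_iff.1 hn, Nat.cast_zero] at hq0
      rw [hn.neg_one_pow, hq0, sub_zero] at hq1
      rw [hq0, hq1, h0, h1, Nat.odd_iff.1 hn.add_one, hn.add_one.neg_one_pow]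
      norm_num
    · rw [Nat.odd_iff.1 hn, Nat.cast_one] at hq0
      rw [hn.neg_one_pow, hq0, sub_eq_iff_eq_add, neg_add_cancel] at hq1
      rw [hq0, hq1, h0, h1, Nat.even_iff.1 hn.add_one, hn.add_one.neg_one_pow]
      norm_num

/-- For every n ≥ 1, q n = h n ∘ q (n-1) : [0,1] → [0,1] is bijective and
continuously differentiable, with q n 0 = n % 2 and q n 1 − q n 0 = (−1)^n. -/
theorem stmt0 : ∀ n : ℕ, 1 ≤ n →
    q n = h n ∘ q (n - 1) ∧
    BijOn (q n) (Icc 0 1) (Icc 0 1) ∧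
    ContDiffOn ℝ 1 (q n) (Icc 0 1) ∧
    q n 0 = (n % 2 : ℕ) ∧
    q n 1 - q n 0 = (-1 : ℝ) ^ n := by
  intro n hn
  refine ⟨?_, bijOn_q n, contDiffOn_q n, q_endpoints n⟩
  obtain ⟨m, rfl⟩ := Nat.exists_eq_add_of_le' hn
  rfl
end
end

section
/- For every n ≥ 0, the X-adic valuation of the polynomial P_n − P_n(0) equals 2^⌊n/2⌋; that is, X^{2^⌊n/2⌋} divides P_n − P_n(0) but X^{2^⌊n/2⌋ + 1} does not. -/
open Set MeasureTheory Polynomial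

noncomputable section

/-- The regularity shared by all stribolic iterates `h n` with `n ≥ 1`. -/
structure IsDecreasingHomeo (g : ℝ → ℝ) : Prop where
  cont : ContinuousOn g (Icc 0 1)
  anti : StrictAntiOn g (Icc 0 1)
  zero : g 0 = 1
  one : g 1 = 0

namespace IsDecreasingHomeo

variable {g : ℝ → ℝ}

theorem mapsTo (hg : IsDecreasingHomeo g) : MapsTo g (Icc 0 1) (Icc 0 1) := by
  intro x hx
  have h0 := hg.anti.antitoneOn (left_mem_Icc.2 zero_le_one) hx hx.1
  have h1 := hg.anti.antitoneOn hx (right_mem_Icc.2 zero_le_one) hx.2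
  rw [hg.zero] at h0
  rw [hg.one] at h1
  exact ⟨h1, h0⟩

theorem surjOn (hg : IsDecreasingHomeo g) : SurjOn g (Icc 0 1) (Icc 0 1) := by
  have := intermediate_value_Icc' zero_le_one hg.cont
  rwa [hg.zero, hg.one] at this

theorem pseudoInv_apply (hg : IsDecreasingHomeo g) {x : ℝ} (hx : x ∈ Icc (0:ℝ) 1) :
    pseudoInv g (g x) = x := by
  have : {z | z ∈ Icc (0:ℝ) 1 ∧ g x ≤ g z} = Icc 0 x := by
    ext z
    constructor
    · rintro ⟨hz, hle⟩
      exact ⟨hz.1, (hg.anti.le_iff_ge hx hz).1 hle⟩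
    · intro hz
      have hz' : z ∈ Icc (0:ℝ) 1 := ⟨hz.1, hz.2.trans hx.2⟩
      exact ⟨hz', hg.anti.antitoneOn hz' hx hz.2⟩
  rw [pseudoInv, this, csSup_Icc hx.1]

end IsDecreasingHomeo

theorem bddAbove_superlevel (g : ℝ → ℝ) (y : ℝ) :
    BddAbove {x | x ∈ Icc (0:ℝ) 1 ∧ y ≤ g x} :=
  ⟨1, fun _ hx => hx.1.2⟩

theorem pseudoInv_mem_Icc (g : ℝ → ℝ) (y : ℝ) : pseudoInv g y ∈ Icc (0:ℝ) 1 :=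
  ⟨Real.sSup_nonneg fun _ hx => hx.1.1, Real.sSup_le (fun _ hx => hx.1.2) zero_le_one⟩

theorem antitone_pseudoInv (g : ℝ → ℝ) : Antitone (pseudoInv g) := by
  intro y z hyz
  rcases Set.eq_empty_or_nonempty {x | x ∈ Icc (0:ℝ) 1 ∧ z ≤ g x} with he | hne
  · have : pseudoInv g z = 0 := by rw [pseudoInv, he, Real.sSup_empty]
    rw [this]
    exact (pseudoInv_mem_Icc g y).1
  · exact csSup_le_csSup (bddAbove_superlevel g y) hne fun x hx => ⟨hx.1, hyz.trans hx.2⟩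

namespace IsDecreasingHomeo

variable {g : ℝ → ℝ}

theorem continuous_pseudoInv (hg : IsDecreasingHomeo g) : Continuous (pseudoInv g) := by
  let f : ℝ → (Icc (0:ℝ) 1)ᵒᵈ := fun y => OrderDual.toDual ⟨pseudoInv g y, pseudoInv_mem_Icc g y⟩
  have hmono : Monotone f := fun y z hyz => antitone_pseudoInv g hyz
  have hsurj : Function.Surjective f := by
    intro x
    exact ⟨g (OrderDual.ofDual x).1, congrArg OrderDual.toDual
      (Subtype.ext (hg.pseudoInv_apply (OrderDual.ofDual x).2))⟩
  have hf : Continuous f := hmono.continuous_of_surjective hsurj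
  exact continuous_subtype_val.comp (continuous_ofDual.comp hf)

theorem pseudoInv_pos (hg : IsDecreasingHomeo g) {y : ℝ} (hy : y ∈ Ico (0:ℝ) 1) :
    0 < pseudoInv g y := by
  obtain ⟨x, hx, rfl⟩ := hg.surjOn ⟨hy.1, hy.2.le⟩
  rw [hg.pseudoInv_apply hx]
  refine lt_of_le_of_ne hx.1 ?_
  rintro rfl
  exact hy.2.ne hg.zero

theorem integral_pseudoInv (hg : IsDecreasingHomeo g) :
    ∫ t in (0:ℝ)..1, pseudoInv g t = ∫ t in (0:ℝ)..1, g t := by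
  have hint : IntegrableOn g (Ioc 0 1) :=
    (hg.cont.integrableOn_Icc).mono_set Ioc_subset_Icc_self
  have hnn : 0 ≤ᵐ[volume.restrict (Ioc (0:ℝ) 1)] g :=
    (ae_restrict_iff' measurableSet_Ioc).2
      (Filter.Eventually.of_forall fun x hx => (hg.mapsTo (Ioc_subset_Icc_self hx)).1)
  rw [intervalIntegral.integral_of_le zero_le_one, intervalIntegral.integral_of_le zero_le_one,
    hint.integral_eq_integral_meas_le hnn, ← Ioc_union_Ioi_eq_Ioi (zero_le_one (α := ℝ))]
  rw [← integral_indicator measurableSet_Ioc,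
    ← integral_indicator (measurableSet_Ioc.union measurableSet_Ioi)]
  congr 1
  funext t
  have key : (volume.restrict (Ioc (0:ℝ) 1)).real {a | t ≤ g a}
      = volume.real ({a | t ≤ g a} ∩ Ioc 0 1) :=
    measureReal_restrict_apply' measurableSet_Ioc
  by_cases h1 : t ∈ Ioc (0:ℝ) 1
  · rw [indicator_of_mem h1, indicator_of_mem (mem_union_left _ h1), key]
    obtain ⟨x, hx, rfl⟩ := hg.surjOn (Ioc_subset_Icc_self h1)
    have : {a | g x ≤ g a} ∩ Ioc 0 1 = Ioc 0 x := by
      ext a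
      constructor
      · rintro ⟨hle, ha⟩
        exact ⟨ha.1, (hg.anti.le_iff_ge hx (Ioc_subset_Icc_self ha)).1 hle⟩
      · intro ha
        have ha' : a ∈ Ioc (0:ℝ) 1 := ⟨ha.1, ha.2.trans hx.2⟩
        exact ⟨hg.anti.antitoneOn (Ioc_subset_Icc_self ha') hx ha.2, ha'⟩
    rw [hg.pseudoInv_apply hx, this, Real.volume_real_Ioc_of_le hx.1, sub_zero]
  · rw [indicator_of_notMem h1]
    by_cases h2 : t ∈ Ioi (1:ℝ)
    · rw [indicator_of_mem (mem_union_right _ h2), key]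
      have : {a | t ≤ g a} ∩ Ioc 0 1 = ∅ := by
        ext a
        simp only [mem_inter_iff, mem_ofPred_eq, mem_empty_iff_false, iff_false, not_and]
        intro hle ha
        exact absurd (hle.trans (hg.mapsTo (Ioc_subset_Icc_self ha)).2) (not_le.2 h2)
      rw [this, measureReal_empty]
    · rw [indicator_of_notMem (by simp only [mem_union]; tauto)]

theorem integral_pos (hg : IsDecreasingHomeo g) : 0 < ∫ t in (0:ℝ)..1, g t := by
  rw [← hg.integral_pseudoInv]
  exact intervalIntegral.intervalIntegral_pos_of_pos_on
    (hg.continuous_pseudoInv.intervalIntegrable _ _)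
    (fun x hx => hg.pseudoInv_pos ⟨hx.1.le, hx.2⟩) zero_lt_one

theorem hasDerivAt_T (hg : IsDecreasingHomeo g) (x : ℝ) :
    HasDerivAt (T g) (-pseudoInv g x / ∫ t in (0:ℝ)..1, g t) x :=
  (intervalIntegral.integral_hasDerivAt_left (hg.continuous_pseudoInv.intervalIntegrable _ _)
    hg.continuous_pseudoInv.aestronglyMeasurable.stronglyMeasurableAtFilter
    hg.continuous_pseudoInv.continuousAt).div_const _

theorem map_T (hg : IsDecreasingHomeo g) : IsDecreasingHomeo (T g) where
  cont x _ := (hg.hasDerivAt_T x).continuousAt.continuousWithinAt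
  anti := by
    refine strictAntiOn_of_deriv_neg (convex_Icc 0 1)
      (fun x _ => (hg.hasDerivAt_T x).continuousAt.continuousWithinAt) fun x hx => ?_
    rw [interior_Icc] at hx
    rw [(hg.hasDerivAt_T x).deriv]
    exact div_neg_of_neg_of_pos (neg_neg_of_pos (hg.pseudoInv_pos ⟨hx.1.le, hx.2⟩)) hg.integral_pos
  zero := by rw [T, hg.integral_pseudoInv, div_self hg.integral_pos.ne']
  one := by rw [T, intervalIntegral.integral_same, zero_div]

end IsDecreasingHomeo

theorem h_one_apply {x : ℝ} (hx : x ∈ Icc (0:ℝ) 1) : h 1 x = 1 - x := by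
  have key : ∫ t in x..(1:ℝ), pseudoInv (h 0) t = ∫ t in x..(1:ℝ), (1:ℝ) := by
    refine intervalIntegral.integral_congr fun t ht => ?_
    rw [uIcc_of_le hx.2] at ht
    have : {z | z ∈ Icc (0:ℝ) 1 ∧ t ≤ h 0 z} = Icc 0 1 := by
      ext z
      exact ⟨fun hz => hz.1, fun hz => ⟨hz, ht.2⟩⟩
    change pseudoInv (h 0) t = 1
    rw [pseudoInv, this, csSup_Icc zero_le_one]
  have hden : ∫ t in (0:ℝ)..1, h 0 t = 1 := by simp [h]
  change (∫ t in x..(1:ℝ), pseudoInv (h 0) t) / (∫ t in (0:ℝ)..1, h 0 t) = 1 - x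
  rw [key, hden]
  simp

theorem isDecreasingHomeo_h (n : ℕ) : IsDecreasingHomeo (h (n + 1)) := by
  induction n with
  | zero =>
    refine ⟨?_, ?_, ?_, ?_⟩
    · exact (continuous_const.sub continuous_id).continuousOn.congr fun x hx => h_one_apply hx
    · intro x hx y hy hxy
      change h 1 y < h 1 x
      rw [h_one_apply hx, h_one_apply hy]
      linarith
    · exact (h_one_apply (left_mem_Icc.2 zero_le_one)).trans (sub_zero 1)
    · exact (h_one_apply (right_mem_Icc.2 zero_le_one)).trans (sub_self 1)
  | succ n ih => exact ih.map_T

theorem mapsTo_q (n : ℕ) : MapsTo (q n) (Icc 0 1) (Icc 0 1) := by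
  induction n with
  | zero => exact fun x hx => hx
  | succ n ih => exact (isDecreasingHomeo_h n).mapsTo.comp ih

theorem q_zero_right (n : ℕ) : q n 0 = if Even n then 0 else 1 := by
  induction n with
  | zero => simp [q]
  | succ n ih =>
    change h (n + 1) (q n 0) = _
    rw [ih]
    by_cases hn : Even n
    · simp [hn, Nat.even_add_one, (isDecreasingHomeo_h n).zero]
    · simp [hn, Nat.even_add_one, (isDecreasingHomeo_h n).one]

/-- `X ^ m` is the exact power of `X` dividing `p`. -/
def HasOrder (p : ℝ[X]) (m : ℕ) : Prop := X ^ m ∣ p ∧ p.coeff m ≠ 0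

theorem HasOrder.mul {p r : ℝ[X]} {a b : ℕ} (hp : HasOrder p a) (hr : HasOrder r b) :
    HasOrder (p * r) (a + b) := by
  obtain ⟨⟨u, rfl⟩, hu⟩ := hp
  obtain ⟨⟨v, rfl⟩, hv⟩ := hr
  have e : X ^ a * u * (X ^ b * v) = X ^ (a + b) * (u * v) := by ring
  refine ⟨⟨u * v, e⟩, ?_⟩
  rw [e, coeff_X_pow_mul', if_pos le_rfl, Nat.sub_self, mul_coeff_zero]
  rw [coeff_X_pow_mul', if_pos le_rfl, Nat.sub_self] at hu hv
  exact mul_ne_zero hu hv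

theorem HasOrder.smul {p : ℝ[X]} {a : ℕ} (hp : HasOrder p a) {c : ℝ} (hc : c ≠ 0) :
    HasOrder (C c * p) a := by
  refine ⟨hp.1.mul_left _, ?_⟩
  rw [coeff_C_mul]
  exact mul_ne_zero hc hp.2

theorem hasOrder_derivative_iff {p : ℝ[X]} {m : ℕ} :
    HasOrder (derivative p) m ↔ HasOrder (p - C (p.eval 0)) (m + 1) := by
  have hne (d : ℕ) : ((d : ℝ) + 1) ≠ 0 := d.cast_add_one_ne_zero
  simp only [HasOrder, X_pow_dvd_iff, coeff_derivative, coeff_sub, coeff_C_succ, sub_zero]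
  refine and_congr ⟨fun H d hd => ?_, fun H d hd => ?_⟩ ?_
  · rcases d with _ | d
    · rw [coeff_C_zero, coeff_zero_eq_eval_zero, sub_self]
    · rw [coeff_C_succ, sub_zero]
      exact (mul_eq_zero.1 (H d (by omega))).resolve_right (hne d)
  · have := H (d + 1) (by omega)
    rw [coeff_C_succ, sub_zero] at this
    rw [this, zero_mul]
  · simp [hne m]

theorem exists_derivative_eq (p : ℝ[X]) : ∃ r : ℝ[X], derivative r = p := by
  induction p using Polynomial.induction_on' with
  | add p r hp hr =>
    obtain ⟨a, rfl⟩ := hp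
    obtain ⟨b, rfl⟩ := hr
    exact ⟨a + b, derivative_add⟩
  | monomial n a =>
    refine ⟨monomial (n + 1) (a / (n + 1)), ?_⟩
    rw [derivative_monomial]
    congr 1
    push_cast
    field_simp

/-- `a` represents `q n` on `[0,1]`, and the order at `0` of its nonconstant part is
`2 ^ (n / 2)`. -/
structure Represents (n : ℕ) (a : ℝ[X]) : Prop where
  eq : ∀ x ∈ Icc (0:ℝ) 1, q n x = a.eval x
  order : HasOrder (a - C (a.eval 0)) (2 ^ (n / 2))

namespace Represents

variable {n : ℕ} {a b : ℝ[X]}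

theorem eval_zero (ha : Represents n a) : a.eval 0 = if Even n then 0 else 1 := by
  rw [← ha.eq 0 (left_mem_Icc.2 zero_le_one), q_zero_right]

theorem order_derivative (ha : Represents n a) : HasOrder (derivative a) (2 ^ (n / 2) - 1) := by
  rw [hasOrder_derivative_iff, Nat.sub_add_cancel Nat.one_le_two_pow]
  exact ha.order

theorem order_mul_derivative (ha : Represents n a) (hb : Represents (n + 1) b) :
    HasOrder (a * derivative b) (2 ^ ((n + 2) / 2) - 1) := by
  have hpos : 1 ≤ 2 ^ (n / 2) := Nat.one_le_two_pow
  by_cases hn : Even n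
  · have hord : HasOrder a (2 ^ (n / 2)) := by
      have := ha.order
      rwa [ha.eval_zero, if_pos hn, C_0, sub_zero] at this
    have := hord.mul hb.order_derivative
    obtain ⟨k, rfl⟩ := hn
    have e1 : (k + k + 1) / 2 = k := by omega
    have e2 : (k + k) / 2 = k := by omega
    have e3 : (k + k + 2) / 2 = k + 1 := by omega
    rw [e1, e2] at this
    rw [e2] at hpos
    rw [e3, pow_succ]
    convert this using 1
    omega
  · have hord : HasOrder a 0 := by
      refine ⟨by simp, ?_⟩
      rw [coeff_zero_eq_eval_zero, ha.eval_zero, if_neg hn]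
      exact one_ne_zero
    have := hord.mul hb.order_derivative
    obtain ⟨k, rfl⟩ := Nat.not_even_iff_odd.1 hn
    have e1 : (2 * k + 1 + 1) / 2 = k + 1 := by omega
    have e3 : (2 * k + 1 + 2) / 2 = k + 1 := by omega
    rwa [e1, zero_add, ← e3] at this

theorem exists_add_two (ha : Represents n a) (hb : Represents (n + 1) b) :
    ∃ c, Represents (n + 2) c := by
  have hg := isDecreasingHomeo_h n
  set k : ℝ := ∫ t in (0:ℝ)..1, h (n + 1) t with hk
  have hk0 : -k⁻¹ ≠ 0 := neg_ne_zero.2 (inv_ne_zero hg.integral_pos.ne')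
  obtain ⟨r, hr⟩ := exists_derivative_eq (C (-k⁻¹) * (a * derivative b))
  have hderiv (x : ℝ) (hx : x ∈ Icc (0:ℝ) 1) :
      HasDerivAt (fun y => h (n + 2) (b.eval y) - r.eval y) 0 x := by
    have h1 := (hg.hasDerivAt_T (b.eval x)).comp x (b.hasDerivAt x)
    have h2 := h1.sub (r.hasDerivAt x)
    refine h2.congr_deriv ?_
    have hb' : b.eval x = h (n + 1) (a.eval x) := by
      rw [← hb.eq x hx, ← ha.eq x hx]
      rfl
    have ha' : a.eval x ∈ Icc (0:ℝ) 1 := by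
      rw [← ha.eq x hx]
      exact mapsTo_q n hx
    have hinv : pseudoInv (h (n + 1)) (b.eval x) = a.eval x := by
      rw [hb', hg.pseudoInv_apply ha']
    rw [hinv, hr, ← hk]
    simp only [eval_mul, eval_C]
    ring
  have hconst := constant_of_has_deriv_right_zero
    (fun x hx => (hderiv x hx).continuousAt.continuousWithinAt)
    (fun x hx => (hderiv x (Ico_subset_Icc_self hx)).hasDerivWithinAt)
  refine ⟨r + C (h (n + 2) (b.eval 0) - r.eval 0), fun x hx => ?_, ?_⟩
  · have := hconst x hx
    change h (n + 2) (q (n + 1) x) = _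
    rw [hb.eq x hx, eval_add, eval_C]
    linarith
  · rw [← Nat.sub_add_cancel (Nat.one_le_two_pow (n := (n + 2) / 2)), ← hasOrder_derivative_iff,
      derivative_add, derivative_C, add_zero, hr]
    exact (ha.order_mul_derivative hb).smul hk0

end Represents

theorem exists_represents_pair (n : ℕ) :
    (∃ a, Represents n a) ∧ ∃ b, Represents (n + 1) b := by
  induction n with
  | zero =>
    refine ⟨⟨X, fun x _ => by simp [q], by simp [HasOrder]⟩,
      ⟨1 - X, fun x hx => ?_, ?_⟩⟩
    · simpa [q] using h_one_apply hx
    · simp [HasOrder]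
  | succ n ih =>
    obtain ⟨⟨a, ha⟩, b, hb⟩ := ih
    exact ⟨⟨b, hb⟩, ha.exists_add_two hb⟩

/-- For every n ≥ 0, the X-adic valuation of P n − P n 0 equals 2^⌊n/2⌋. -/
theorem stmt5 : ∀ n : ℕ, ∀ P : Polynomial ℚ,
    (∀ x ∈ Icc (0:ℝ) 1, q n x = aeval x P) →
    (X : Polynomial ℚ) ^ (2 ^ (n / 2)) ∣ (P - C (P.eval 0)) ∧
    ¬ (X : Polynomial ℚ) ^ (2 ^ (n / 2) + 1) ∣ (P - C (P.eval 0)) := by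
  intro n P hP
  obtain ⟨a, ha⟩ := (exists_represents_pair n).1
  have hmap : P.map (algebraMap ℚ ℝ) = a := by
    refine eq_of_infinite_eval_eq _ _ ((Icc_infinite (zero_lt_one (α := ℝ))).mono fun x hx => ?_)
    change eval x (P.map (algebraMap ℚ ℝ)) = eval x a
    rw [eval_map_algebraMap, ← hP x hx, ha.eq x hx]
  have hcoeff (d : ℕ) :
      (a - C (a.eval 0)).coeff d = algebraMap ℚ ℝ ((P - C (P.eval 0)).coeff d) := by
    rw [← coeff_map, Polynomial.map_sub, hmap, map_C, ← hmap, ← coeff_zero_eq_eval_zero,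
      coeff_map, coeff_zero_eq_eval_zero]
  have hinj := (algebraMap ℚ ℝ).injective
  obtain ⟨hdvd, hne⟩ := ha.order
  rw [X_pow_dvd_iff] at hdvd
  rw [X_pow_dvd_iff, X_pow_dvd_iff]
  refine ⟨fun d hd => hinj ?_, fun H => hne ?_⟩
  · rw [← hcoeff, hdvd d hd, map_zero]
  · rw [hcoeff, H _ (Nat.lt_succ_self _), map_zero]
end
end

section
/- Assume that θ_{2m} < θ_{2m+2} < θ_{2m+3} < θ_{2m+1} holds for all m ≥ 1. Then for every m ≥ 1, κ'_{2m-1} < κ < κ'_{2m}, where κ := inf_{n≥0} κ_n. -/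
open Set MeasureTheory Polynomial

noncomputable section

/-- The quotients θ n = (κ n − κ (n+1)) / (κ (n-1) − κ n). -/
def θ (n : ℕ) : ℝ := (κ n - κ (n + 1)) / (κ (n - 1) - κ n)

/-- κ' n = (κ n − θ n * κ (n-1)) / (1 − θ n). -/
def κ' (n : ℕ) : ℝ := (κ n - θ n * κ (n - 1)) / (1 - θ n)

open Filter Topology

/-- If the ratios of consecutive differences of `k` stay below `r`, then extrapolating `k`
geometrically with ratio `r` underestimates its limit. -/
lemma lt_of_tendsto_of_ratio_lt {k : ℕ → ℝ} {l r : ℝ} (hl : Tendsto k atTop (𝓝 l)) (hr : r < 1)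
    {n : ℕ} (hk : ∀ i, n ≤ i → k (i + 1) - k (i + 2) < r * (k i - k (i + 1))) :
    (k (n + 1) - r * k n) / (1 - r) < l := by
  have hr' : 0 < 1 - r := by linarith
  have hmono : StrictMono fun i => (k (n + i + 1) - r * k (n + i)) / (1 - r) := by
    refine strictMono_nat_of_lt_succ fun i => ?_
    have := hk (n + i) (by omega)
    rw [div_lt_div_iff_of_pos_right hr', show n + (i + 1) + 1 = n + i + 2 by ring,
      show n + (i + 1) = n + i + 1 by ring]
    linarith
  have hlim : Tendsto (fun i => (k (n + i + 1) - r * k (n + i)) / (1 - r)) atTop (𝓝 l) := by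
    have h0 : Tendsto (fun i => k (n + i)) atTop (𝓝 l) := by
      simpa [add_comm] using (tendsto_add_atTop_iff_nat n).2 hl
    have h1 : Tendsto (fun i => k (n + i + 1)) atTop (𝓝 l) := (tendsto_add_atTop_iff_nat 1).2 h0
    have := (h1.sub (h0.const_mul r)).div_const (1 - r)
    rwa [show (l - r * l) / (1 - r) = l by field_simp] at this
  calc _ < _ := hmono zero_lt_one
    _ ≤ l := hmono.monotone.ge_of_tendsto hlim 1

lemma gt_of_tendsto_of_lt_ratio {k : ℕ → ℝ} {l r : ℝ} (hl : Tendsto k atTop (𝓝 l)) (hr : r < 1)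
    {n : ℕ} (hk : ∀ i, n ≤ i → r * (k i - k (i + 1)) < k (i + 1) - k (i + 2)) :
    l < (k (n + 1) - r * k n) / (1 - r) := by
  have := lt_of_tendsto_of_ratio_lt (k := fun i => -k i) hl.neg hr (n := n)
    fun i hi => by linarith [hk i hi]
  rw [show -k (n + 1) - r * -k n = -(k (n + 1) - r * k n) by ring, neg_div] at this
  linarith

/-- A decreasing sequence whose differences decay geometrically converges to its infimum. -/
lemma tendsto_iInf_of_ratio_le {k : ℕ → ℝ} {r : ℝ} (hanti : Antitone k) (hr0 : 0 ≤ r) (hr : r < 1)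
    {n : ℕ} (hk : ∀ i, n ≤ i → k (i + 1) - k (i + 2) ≤ r * (k i - k (i + 1))) :
    Tendsto k atTop (𝓝 (⨅ i, k i)) := by
  have hmono : Monotone fun i => k (n + i + 1) - r * k (n + i) := by
    refine monotone_nat_of_le_succ fun i => ?_
    have := hk (n + i) (by omega)
    rw [show n + (i + 1) + 1 = n + i + 2 by ring, show n + (i + 1) = n + i + 1 by ring]
    linarith
  refine tendsto_atTop_ciInf hanti ⟨(k (n + 1) - r * k n) / (1 - r), ?_⟩
  rintro _ ⟨i, rfl⟩
  have h1 : k (n + 1) - r * k n ≤ k (n + i + 1) - r * k (n + i) := hmono (Nat.zero_le i)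
  have h2 : k (n + i + 1) ≤ k i := hanti (by omega)
  have h3 : k (n + i + 1) ≤ k (n + i) := hanti (by omega)
  have h4 : k (n + i) ≤ k i := hanti (by omega)
  rw [div_le_iff₀ (by linarith)]
  nlinarith [mul_le_mul_of_nonneg_left h3 hr0]

lemma pseudoInv_eq_of_galois {g : ℝ → ℝ} {y z : ℝ} (hz : z ∈ Icc (0 : ℝ) 1)
    (hg : ∀ x ∈ Icc (0 : ℝ) 1, y ≤ g x ↔ x ≤ z) : pseudoInv g y = z :=
  IsGreatest.csSup_eq ⟨⟨hz, (hg z hz).2 le_rfl⟩, fun _ hx => (hg _ hx.1).1 hx.2⟩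

lemma pseudoInv_congr {f g : ℝ → ℝ} (hfg : EqOn f g (Icc 0 1)) : pseudoInv f = pseudoInv g := by
  funext y
  unfold pseudoInv
  congr 1
  ext x
  exact and_congr_right fun hx => by rw [hfg hx]

lemma pseudoInv_eq_integral {g : ℝ → ℝ} (hg : Continuous g) (hanti : AntitoneOn g (Icc 0 1))
    (h0 : g 0 = 1) {y : ℝ} (hy : y ≤ 1) :
    pseudoInv g y = ∫ x in (0 : ℝ)..1, {x | y ≤ g x}.indicator 1 x := by
  set S := {x | x ∈ Icc (0 : ℝ) 1 ∧ y ≤ g x} with hS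
  have hclosed : IsClosed S := isClosed_Icc.inter (isClosed_le continuous_const hg)
  have hbdd : BddAbove S := ⟨1, fun x hx => hx.1.2⟩
  have hmem : sSup S ∈ S := hclosed.csSup_mem ⟨0, by simp, by rwa [h0]⟩ hbdd
  have hset : Ioc (0 : ℝ) 1 ∩ {x | y ≤ g x} = Ioc 0 (sSup S) := by
    ext x
    constructor
    · rintro ⟨hx, hxy⟩
      exact ⟨hx.1, le_csSup hbdd ⟨Ioc_subset_Icc_self hx, hxy⟩⟩
    · rintro ⟨hx, hxs⟩
      have hx1 := hxs.trans hmem.1.2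
      exact ⟨⟨hx, hx1⟩, hmem.2.trans (hanti ⟨hx.le, hx1⟩ hmem.1 hxs)⟩
  rw [intervalIntegral.integral_of_le zero_le_one,
    setIntegral_indicator (measurableSet_le measurable_const hg.measurable), hset]
  rw [pseudoInv, ← hS]
  simp [hmem.1.1]

lemma integral_indicator_Iic {c y : ℝ} (hc : c ≤ 1) (hy : y ≤ 1) :
    ∫ t in y..1, (Iic c).indicator (1 : ℝ → ℝ) t = max (c - y) 0 := by
  rw [intervalIntegral.integral_of_le hy, setIntegral_indicator measurableSet_Iic,
    Ioc_inter_Iic, min_eq_right hc]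
  simp

lemma integral_max_sub_zero {c : ℝ} (hc : c ∈ Icc (0 : ℝ) 1) :
    ∫ y in (0 : ℝ)..1, max (c - y) 0 = c ^ 2 / 2 := by
  have hcont : Continuous fun y : ℝ => max (c - y) 0 := by fun_prop
  rw [← intervalIntegral.integral_add_adjacent_intervals (b := c)
    (hcont.intervalIntegrable _ _) (hcont.intervalIntegrable _ _)]
  have h1 : ∫ y in (0 : ℝ)..c, max (c - y) 0 = ∫ y in (0 : ℝ)..c, (c - y) := by
    refine intervalIntegral.integral_congr fun y hy => ?_
    rw [uIcc_of_le hc.1] at hy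
    exact max_eq_left (by linarith [hy.2])
  have h2 : ∫ y in c..1, max (c - y) 0 = ∫ y in c..1, (0 : ℝ) := by
    refine intervalIntegral.integral_congr fun y hy => ?_
    rw [uIcc_of_le hc.2] at hy
    exact max_eq_right (by linarith [hy.1])
  rw [h1, h2, intervalIntegral.integral_sub (by simp) (by simp)]
  simp
  ring

lemma integral_pseudoInv {g : ℝ → ℝ} (hg : Continuous g) (hanti : AntitoneOn g (Icc 0 1))
    (h0 : g 0 = 1) {y : ℝ} (hy : y ≤ 1) :
    ∫ t in y..1, pseudoInv g t = ∫ x in (0 : ℝ)..1, max (g x - y) 0 := by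
  calc ∫ t in y..1, pseudoInv g t
      = ∫ t in y..1, ∫ x in (0 : ℝ)..1, {x | t ≤ g x}.indicator 1 x := by
        refine intervalIntegral.integral_congr fun t ht => ?_
        rw [uIcc_of_le hy] at ht
        exact pseudoInv_eq_integral hg hanti h0 ht.2
    _ = ∫ x in (0 : ℝ)..1, ∫ t in y..1, {x | t ≤ g x}.indicator 1 x := by
        refine intervalIntegral_intervalIntegral_swap ?_
        have hms : MeasurableSet {p : ℝ × ℝ | p.1 ≤ g p.2} :=
          measurableSet_le measurable_fst (hg.measurable.comp measurable_snd)
        have heq : Function.uncurry (fun t x : ℝ => {x | t ≤ g x}.indicator (1 : ℝ → ℝ) x)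
            = {p : ℝ × ℝ | p.1 ≤ g p.2}.indicator 1 := rfl
        rw [heq]
        have hfin : volume (uIoc y 1 ×ˢ uIoc (0 : ℝ) 1) ≠ ⊤ := by
          rw [Measure.volume_eq_prod, Measure.prod_prod]
          exact (ENNReal.mul_lt_top (by simp [uIoc]) (by simp [uIoc])).ne
        exact (integrableOn_const (C := (1 : ℝ)) hfin).indicator hms
    _ = ∫ x in (0 : ℝ)..1, max (g x - y) 0 := by
        refine intervalIntegral.integral_congr fun x hx => ?_
        rw [uIcc_of_le zero_le_one] at hx
        exact integral_indicator_Iic (h0 ▸ hanti (by simp) hx hx.1) hy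

lemma integral_T {g : ℝ → ℝ} (hg : Continuous g) (hanti : AntitoneOn g (Icc 0 1))
    (h0 : g 0 = 1) (h1 : 0 ≤ g 1) :
    ∫ y in (0 : ℝ)..1, T g y
      = (∫ x in (0 : ℝ)..1, g x ^ 2 / 2) / ∫ x in (0 : ℝ)..1, g x := by
  simp only [T]
  rw [intervalIntegral.integral_div]
  congr 1
  calc ∫ y in (0 : ℝ)..1, ∫ t in y..1, pseudoInv g t
      = ∫ y in (0 : ℝ)..1, ∫ x in (0 : ℝ)..1, max (g x - y) 0 := by
        refine intervalIntegral.integral_congr fun y hy => ?_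
        rw [uIcc_of_le zero_le_one] at hy
        exact integral_pseudoInv hg hanti h0 hy.2
    _ = ∫ x in (0 : ℝ)..1, ∫ y in (0 : ℝ)..1, max (g x - y) 0 := by
        refine intervalIntegral_intervalIntegral_swap ?_
        have hc : Continuous (Function.uncurry fun y x : ℝ => max (g x - y) 0) := by
          simp only [Function.uncurry_def]
          fun_prop
        exact (hc.continuousOn.integrableOn_compact
          (isCompact_uIcc.prod isCompact_uIcc)).mono_set
            (prod_mono uIoc_subset_uIcc uIoc_subset_uIcc)
    _ = ∫ x in (0 : ℝ)..1, g x ^ 2 / 2 := by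
        refine intervalIntegral.integral_congr fun x hx => ?_
        rw [uIcc_of_le zero_le_one] at hx
        exact integral_max_sub_zero ⟨h1.trans (hanti hx (by simp) hx.2),
          h0 ▸ hanti (by simp) hx hx.1⟩

lemma T_congr {f g : ℝ → ℝ} (hfg : EqOn f g (Icc 0 1)) : T f = T g := by
  have : ∫ t in (0 : ℝ)..1, f t = ∫ t in (0 : ℝ)..1, g t :=
    intervalIntegral.integral_congr (by rwa [uIcc_of_le zero_le_one])
  funext x
  rw [T, T, pseudoInv_congr hfg, this]

lemma integral_T_of_eqOn {f g : ℝ → ℝ} (hfg : EqOn f g (Icc 0 1)) :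
    ∫ t in (0 : ℝ)..1, T f t = ∫ t in (0 : ℝ)..1, T g t := by
  rw [T_congr hfg]

/-- If `g*` is `f` on `[0,1]`, then `T g` is the primitive of `f`, normalized. -/
lemma T_eqOn {g f : ℝ → ℝ} (hf : EqOn (pseudoInv g) f (Icc 0 1)) :
    EqOn (T g) (fun x => (∫ t in x..(1 : ℝ), f t) / ∫ t in (0 : ℝ)..1, g t) (Icc 0 1) := by
  intro x hx
  have : ∫ t in x..(1 : ℝ), pseudoInv g t = ∫ t in x..(1 : ℝ), f t := by
    refine intervalIntegral.integral_congr fun t ht => hf ?_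
    rw [uIcc_of_le hx.2] at ht
    exact ⟨hx.1.trans ht.1, ht.2⟩
  simp only [T, this]

lemma κ_eq_of_eqOn {n : ℕ} {g : ℝ → ℝ} (hg : EqOn (h n) g (Icc 0 1)) :
    κ n = ∫ t in (0 : ℝ)..1, g t :=
  intervalIntegral.integral_congr (by rwa [uIcc_of_le zero_le_one])

lemma h_succ_eqOn {n : ℕ} {g f : ℝ → ℝ} (hg : EqOn (h n) g (Icc 0 1))
    (hf : EqOn (pseudoInv g) f (Icc 0 1)) :
    EqOn (h (n + 1)) (fun x => (∫ t in x..(1 : ℝ), f t) / κ n) (Icc 0 1) := by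
  rw [← pseudoInv_congr hg] at hf
  exact T_eqOn hf

lemma κ_zero : κ 0 = 1 := by simp [κ, h]

lemma h_one_eqOn : EqOn (h 1) (fun x => 1 - x) (Icc 0 1) := by
  have h0 : EqOn (h 0) (fun _ => 1) (Icc 0 1) := fun x _ => rfl
  have hf : EqOn (pseudoInv fun _ => 1) (fun _ => 1) (Icc 0 1) := fun y hy =>
    pseudoInv_eq_of_galois (by simp) fun x hx => by simp [hx.2, hy.2]
  intro x hx
  simpa [κ_zero] using h_succ_eqOn h0 hf hx

lemma κ_one : κ 1 = 1 / 2 := by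
  rw [κ_eq_of_eqOn h_one_eqOn, intervalIntegral.integral_sub (by simp) (by simp)]
  norm_num

lemma integral_one_sub (x : ℝ) : ∫ t in x..(1 : ℝ), (1 - t) = (1 - x) ^ 2 / 2 := by
  rw [intervalIntegral.integral_sub (by simp) (by simp)]
  simp
  ring

lemma h_two_eqOn : EqOn (h 2) (fun x => (1 - x) ^ 2) (Icc 0 1) := by
  have hf : EqOn (pseudoInv fun x => 1 - x) (fun y => 1 - y) (Icc 0 1) := fun y hy =>
    pseudoInv_eq_of_galois ⟨by linarith [hy.2], by linarith [hy.1]⟩ fun x _ => by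
      constructor <;> intro _ <;> linarith
  intro x hx
  rw [h_succ_eqOn h_one_eqOn hf hx, κ_one]
  simp only [integral_one_sub]
  ring

lemma κ_two : κ 2 = 1 / 3 := by
  rw [κ_eq_of_eqOn h_two_eqOn,
    intervalIntegral.integral_comp_sub_left (fun x : ℝ => x ^ 2) 1, integral_pow]
  norm_num

lemma integral_sqrt_pow_mul (n : ℕ) {x : ℝ} (hx : 0 ≤ x) :
    ∫ t in (0 : ℝ)..x, t ^ n * √t = x ^ (n + 1) * √x / (n + 3 / 2) := by
  have h1 : ∫ t in (0 : ℝ)..x, t ^ n * √t = ∫ t in (0 : ℝ)..x, t ^ ((n : ℝ) + 1 / 2) := by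
    refine intervalIntegral.integral_congr fun t ht => ?_
    rw [uIcc_of_le hx] at ht
    rw [Real.rpow_add_of_nonneg ht.1 (by positivity) (by norm_num), Real.rpow_natCast,
      Real.sqrt_eq_rpow]
  have hn : (0 : ℝ) < n + 1 / 2 + 1 := by positivity
  rw [h1, integral_rpow (Or.inl (by linarith)), Real.zero_rpow hn.ne',
    show (n : ℝ) + 1 / 2 + 1 = ((n + 1 : ℕ) : ℝ) + 1 / 2 by push_cast; ring,
    Real.rpow_add_of_nonneg hx (by positivity) (by norm_num), Real.rpow_natCast,
    ← Real.sqrt_eq_rpow]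
  congr 1
  · ring
  · push_cast
    ring

lemma h_three_eqOn : EqOn (h 3) (fun x => 1 - 3 * x + 2 * (x * √x)) (Icc 0 1) := by
  have hf : EqOn (pseudoInv fun x => (1 - x) ^ 2) (fun y => 1 - √y) (Icc 0 1) := fun y hy =>
    pseudoInv_eq_of_galois ⟨by linarith [Real.sqrt_le_one.2 hy.2], by linarith [Real.sqrt_nonneg y]⟩
      fun x hx => by
        rw [← Real.sqrt_le_left (by linarith [hx.2])]
        constructor <;> intro _ <;> linarith
  intro x hx
  rw [h_succ_eqOn h_two_eqOn hf hx, κ_two]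
  have hint : ∀ a b : ℝ, IntervalIntegrable (fun t : ℝ => 1 - √t) volume a b := fun a b =>
    Continuous.intervalIntegrable (by fun_prop) a b
  have hprim : ∀ y : ℝ, 0 ≤ y → ∫ t in (0 : ℝ)..y, (1 - √t) = y - 2 / 3 * (y * √y) := by
    intro y hy
    rw [intervalIntegral.integral_sub (by simp) (Real.continuous_sqrt.intervalIntegrable _ _)]
    have := integral_sqrt_pow_mul 0 hy
    simp only [pow_zero, one_mul, zero_add, pow_one, CharP.cast_eq_zero] at this
    rw [this]
    simp
    ring
  have hsub := intervalIntegral.integral_interval_sub_left (hint 0 1) (hint 0 x)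
  rw [hprim 1 zero_le_one, hprim x hx.1] at hsub
  simp only [← hsub, Real.sqrt_one]
  ring

lemma integral_mul_sqrt : ∫ t in (0 : ℝ)..1, t * √t = 2 / 5 := by
  have := integral_sqrt_pow_mul 1 zero_le_one
  norm_num at this
  exact this

lemma κ_three : κ 3 = 3 / 10 := by
  rw [κ_eq_of_eqOn h_three_eqOn, intervalIntegral.integral_add
      (Continuous.intervalIntegrable (by fun_prop) _ _)
      (Continuous.intervalIntegrable (by fun_prop) _ _),
    intervalIntegral.integral_sub (by simp) (Continuous.intervalIntegrable (by fun_prop) _ _),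
    intervalIntegral.integral_const_mul, intervalIntegral.integral_const_mul, integral_mul_sqrt]
  norm_num

lemma antitoneOn_one_sub_three_mul_add :
    AntitoneOn (fun x : ℝ => 1 - 3 * x + 2 * (x * √x)) (Icc 0 1) := by
  intro x hx y hy hxy
  have hs0 := Real.sqrt_nonneg x
  have hst := Real.sqrt_le_sqrt hxy
  have ht1 := Real.sqrt_le_one.2 hy.2
  have hxs := Real.sq_sqrt hx.1
  have hyt := Real.sq_sqrt hy.1
  simp only
  set s := √x
  set t := √y
  rw [← hxs, ← hyt]
  have : 0 ≤ 3 * (t + s) - 2 * (t ^ 2 + t * s + s ^ 2) := by nlinarith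
  nlinarith [mul_nonneg (sub_nonneg.2 hst) this]

lemma κ_four : κ 4 = 2 / 7 := by
  have hsq : ∫ x in (0 : ℝ)..1, (1 - 3 * x + 2 * (x * √x)) ^ 2 / 2 = 3 / 35 := by
    have hcongr : ∫ x in (0 : ℝ)..1, (1 - 3 * x + 2 * (x * √x)) ^ 2 / 2
        = ∫ x in (0 : ℝ)..1,
          ((1 / 2 - 3 * x + 9 / 2 * x ^ 2 + 2 * x ^ 3) + (2 * (x * √x) - 6 * (x ^ 2 * √x))) := by
      refine intervalIntegral.integral_congr fun x hx => ?_
      rw [uIcc_of_le zero_le_one] at hx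
      have := Real.sq_sqrt hx.1
      linear_combination 2 * x ^ 2 * this
    have hpoly : ∫ x in (0 : ℝ)..1, (1 / 2 - 3 * x + 9 / 2 * x ^ 2 + 2 * x ^ 3) = 1 := by
      rw [intervalIntegral.integral_add (Continuous.intervalIntegrable (by fun_prop) _ _)
          (Continuous.intervalIntegrable (by fun_prop) _ _),
        intervalIntegral.integral_add (Continuous.intervalIntegrable (by fun_prop) _ _)
          (Continuous.intervalIntegrable (by fun_prop) _ _),
        intervalIntegral.integral_sub (by simp)
          (Continuous.intervalIntegrable (by fun_prop) _ _)]
      rw [intervalIntegral.integral_const_mul, intervalIntegral.integral_const_mul,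
        intervalIntegral.integral_const_mul, integral_id, integral_pow, integral_pow]
      norm_num
    rw [hcongr, intervalIntegral.integral_add (Continuous.intervalIntegrable (by fun_prop) _ _)
        (Continuous.intervalIntegrable (by fun_prop) _ _), hpoly,
      intervalIntegral.integral_sub (Continuous.intervalIntegrable (by fun_prop) _ _)
        (Continuous.intervalIntegrable (by fun_prop) _ _),
      intervalIntegral.integral_const_mul, intervalIntegral.integral_const_mul,
      integral_mul_sqrt, integral_sqrt_pow_mul 2 zero_le_one]
    norm_num
  have hT : κ 4 = ∫ y in (0 : ℝ)..1, T (fun x => 1 - 3 * x + 2 * (x * √x)) y :=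
    integral_T_of_eqOn h_three_eqOn
  rw [hT, integral_T (by fun_prop) antitoneOn_one_sub_three_mul_add (by simp) (by norm_num), hsq,
    ← κ_eq_of_eqOn h_three_eqOn, κ_three]
  norm_num

/-- Assuming θ (2m) < θ (2m+2) < θ (2m+3) < θ (2m+1) for all m ≥ 1, we get
κ' (2m−1) < κ < κ' (2m) for all m ≥ 1, where κ = inf_n κ n. -/
theorem stmt8
    (hconj : ∀ m : ℕ, 1 ≤ m →
      θ (2 * m) < θ (2 * m + 2) ∧ θ (2 * m + 2) < θ (2 * m + 3) ∧
      θ (2 * m + 3) < θ (2 * m + 1)) :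
    ∀ m : ℕ, 1 ≤ m →
      κ' (2 * m - 1) < (⨅ n : ℕ, κ n) ∧ (⨅ n : ℕ, κ n) < κ' (2 * m) := by
  have hθ2 : θ 2 = 1 / 5 := by norm_num [θ, κ_one, κ_two, κ_three]
  have hθ3 : θ 3 = 3 / 7 := by norm_num [θ, κ_two, κ_three, κ_four]
  have heven : StrictMono fun j => θ (2 * (j + 1)) :=
    strictMono_nat_of_lt_succ fun j => (hconj (j + 1) (by omega)).1
  have hodd : StrictAnti fun j => θ (2 * (j + 1) + 1) :=
    strictAnti_nat_of_succ_lt fun j => (hconj (j + 1) (by omega)).2.2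
  have hlt : ∀ j, θ (2 * (j + 1)) < θ (2 * (j + 1) + 1) := by
    rintro (_ | j)
    · norm_num [hθ2, hθ3]
    · exact (hconj (j + 1) (by omega)).2.1
  have hgt_even : ∀ j n, 2 * (j + 1) < n → θ (2 * (j + 1)) < θ n := by
    intro j n hn
    obtain ⟨i, rfl | rfl⟩ : ∃ i, n = 2 * (i + 1) ∨ n = 2 * (i + 1) + 1 :=
      ⟨n / 2 - 1, by omega⟩
    · exact heven (show j < i by omega)
    · exact (heven.monotone (show j ≤ i by omega)).trans_lt (hlt i)
  have hlt_odd : ∀ j n, 2 * (j + 1) + 1 < n → θ n < θ (2 * (j + 1) + 1) := by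
    intro j n hn
    obtain ⟨i, rfl | rfl⟩ : ∃ i, n = 2 * (i + 1) ∨ n = 2 * (i + 1) + 1 :=
      ⟨n / 2 - 1, by omega⟩
    · exact (hlt i).trans_le (hodd.antitone (show j ≤ i by omega))
    · exact hodd (show j < i by omega)
  have hpos : ∀ n, 2 ≤ n → 0 < θ n := by
    intro n hn
    rcases hn.eq_or_lt with rfl | hn
    · norm_num [hθ2]
    · exact lt_trans (by norm_num [hθ2]) (hgt_even 0 n hn)
  have hle : ∀ n, 2 ≤ n → θ n ≤ 3 / 7 := by
    intro n hn
    obtain rfl | rfl | hn : n = 2 ∨ n = 3 ∨ 3 < n := by omega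
    · norm_num [hθ2]
    · exact hθ3.le
    · exact hθ3 ▸ (hlt_odd 0 n hn).le
  have hd : ∀ n, 0 < κ n - κ (n + 1) := by
    intro n
    induction n with
    | zero => norm_num [κ_zero, κ_one]
    | succ n ih =>
      rcases n with _ | n
      · norm_num [κ_one, κ_two]
      · exact (div_pos_iff_of_pos_right ih).1 (hpos (n + 2) (by omega))
  have hθd : ∀ n, κ (n + 1) - κ (n + 2) = θ (n + 1) * (κ n - κ (n + 1)) := fun n =>
    (div_mul_cancel₀ _ (hd n).ne').symm
  have hlim : Tendsto κ atTop (𝓝 (⨅ n, κ n)) := by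
    refine tendsto_iInf_of_ratio_le (r := 3 / 7) (n := 1)
      (antitone_nat_of_succ_le fun n => by linarith [hd n]) (by norm_num) (by norm_num)
      fun i hi => ?_
    rw [hθd]
    exact mul_le_mul_of_nonneg_right (hle _ (by omega)) (hd i).le
  have hκ' : ∀ n, κ' (n + 1) = (κ (n + 2) - θ (n + 1) * κ (n + 1)) / (1 - θ (n + 1)) := by
    intro n
    rw [κ', Nat.add_sub_cancel]
    congr 1
    linear_combination hθd n
  have hlower : ∀ j, κ' (2 * (j + 1) + 1) < ⨅ n, κ n := by
    intro j
    rw [hκ']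
    refine lt_of_tendsto_of_ratio_lt hlim
      ((hle (2 * (j + 1) + 1) (by omega)).trans_lt (by norm_num)) fun i hi => ?_
    rw [hθd]
    exact mul_lt_mul_of_pos_right (hlt_odd j _ (by omega)) (hd i)
  have hupper : ∀ j, (⨅ n, κ n) < κ' (2 * (j + 1)) := by
    intro j
    rw [show 2 * (j + 1) = 2 * j + 1 + 1 by ring, hκ']
    refine gt_of_tendsto_of_lt_ratio hlim
      ((hle (2 * j + 1 + 1) (by omega)).trans_lt (by norm_num)) fun i hi => ?_
    rw [hθd]
    exact mul_lt_mul_of_pos_right (hgt_even j _ (by omega)) (hd i)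
  intro m hm
  obtain ⟨m, rfl⟩ := Nat.exists_eq_add_of_le' hm
  refine ⟨?_, hupper m⟩
  rcases m with _ | m
  · have hκ'_lt : κ' 1 < κ' 3 := by
      norm_num [κ', hθ3, θ, κ_zero, κ_one, κ_two, κ_three, κ_four]
    exact hκ'_lt.trans (hlower 0)
  · exact hlower m
end
end
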